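/- arXiv:2003.03538 — 6 statements merged into one kernel-verified Lean document; each statement's English description precedes it below -/
import Mathlib

section
/- Let S be a seminorm, not identically zero, on an infinite-dimensional vector space X over 𝔽 (the real or complex numbers). Then there exists a norm on X with respect to whose induced topology S is discontinuous at every point of X. -/
/-- `S` is a seminorm on the vector space `X` over `𝕜`:
nonnegative, absolutely homogeneous, and subadditive. -/
def IsSeminorm (𝕜 : Type*) {X : Type*} [RCLike 𝕜] [AddCommGroup X] [Module 𝕜 X]
    (S : X → ℝ) : Prop :=
  (∀ x, 0 ≤ S x) ∧ (∀ (a : 𝕜) (x : X), S (a • x) = ‖a‖ * S x) ∧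
    ∀ x y, S (x + y) ≤ S x + S y

/-- `N` is a norm on `X`: a seminorm which is positive on nonzero vectors. -/
def IsNorm (𝕜 : Type*) {X : Type*} [RCLike 𝕜] [AddCommGroup X] [Module 𝕜 X]
    (N : X → ℝ) : Prop :=
  IsSeminorm 𝕜 N ∧ ∀ x, x ≠ 0 → 0 < N x

/-- `S` is a proper seminorm: it does not vanish identically, and it vanishes
at some nonzero vector. -/
def IsProperSeminorm (𝕜 : Type*) {X : Type*} [RCLike 𝕜] [AddCommGroup X] [Module 𝕜 X]
    (S : X → ℝ) : Prop :=
  IsSeminorm 𝕜 S ∧ (∃ x, S x ≠ 0) ∧ ∃ x, x ≠ 0 ∧ S x = 0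

/-- `S` is continuous at the point `x` with respect to the topology induced by
the norm `N` (ε-δ formulation of continuity in the metric induced by `N`). -/
def ContAtWRT {X : Type*} [AddCommGroup X] (N S : X → ℝ) (x : X) : Prop :=
  ∀ ε > 0, ∃ δ > 0, ∀ y, N (y - x) < δ → |S y - S x| < ε

/-- `u` is a Cauchy sequence with respect to the norm `N`. -/
def NCauchy {X : Type*} [AddCommGroup X] (N : X → ℝ) (u : ℕ → X) : Prop :=
  ∀ ε > 0, ∃ M, ∀ n ≥ M, ∀ m ≥ M, N (u n - u m) < ε

/-- `u` tends to `x` with respect to the norm `N`. -/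
def NTendsto {X : Type*} [AddCommGroup X] (N : X → ℝ) (u : ℕ → X) (x : X) : Prop :=
  ∀ ε > 0, ∃ M, ∀ n ≥ M, N (u n - x) < ε

/-- The norm `N` is complete: every `N`-Cauchy sequence has an `N`-limit. -/
def NComplete {X : Type*} [AddCommGroup X] (N : X → ℝ) : Prop :=
  ∀ u : ℕ → X, NCauchy N u → ∃ x, NTendsto N u x

/-- The norms `N₁` and `N₂` are equivalent: there are constants `0 < β ≤ γ`
with `β N₁(x) ≤ N₂(x) ≤ γ N₁(x)` for all `x`. -/
def NormEquiv {X : Type*} (N₁ N₂ : X → ℝ) : Prop :=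
  ∃ β γ : ℝ, 0 < β ∧ β ≤ γ ∧ ∀ x, β * N₁ x ≤ N₂ x ∧ N₂ x ≤ γ * N₁ x


theorem aux_zero {𝕜 X : Type*} [RCLike 𝕜] [AddCommGroup X] [Module 𝕜 X]
    {S : X → ℝ} (hS : IsSeminorm 𝕜 S) : S 0 = 0 := by
  have h := hS.2.1 0 0
  simpa using h

theorem aux_neg {𝕜 X : Type*} [RCLike 𝕜] [AddCommGroup X] [Module 𝕜 X]
    {S : X → ℝ} (hS : IsSeminorm 𝕜 S) (x : X) : S (-x) = S x := by
  have h := hS.2.1 (-1) x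
  simpa using h

theorem aux_disc {𝕜 X : Type*} [RCLike 𝕜] [AddCommGroup X] [Module 𝕜 X]
    {S N : X → ℝ} (hS : IsSeminorm 𝕜 S) (hN : IsNorm 𝕜 N)
    (h : ¬ ∃ C : ℝ, ∀ x, S x ≤ C * N x) (x : X) : ¬ ContAtWRT N S x := by
  intro hc
  obtain ⟨δ, hδ, hy⟩ := hc 1 one_pos
  apply h
  refine ⟨(2 * S x + 1) * (2 / δ), fun z => ?_⟩
  by_cases hz : z = 0
  · subst hz
    rw [aux_zero hS, aux_zero hN.1]; simp
  have hNz := hN.2 z hz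
  set t : ℝ := δ / (2 * N z) with ht
  have htpos : 0 < t := by positivity
  have hn : ‖((t : ℝ) : 𝕜)‖ = t := by rw [RCLike.norm_ofReal, abs_of_pos htpos]
  have h1 := hy (x + (t : 𝕜) • z) (by
    rw [add_sub_cancel_left, hN.1.2.1, hn, ht]
    field_simp
    norm_num)
  have h2 := hS.2.2 (x + (t : 𝕜) • z) (-x)
  rw [aux_neg hS, add_neg_cancel_comm, hS.2.1, hn] at h2
  have h3 := (abs_lt.1 h1).2
  have h4 : t * S z ≤ 2 * S x + 1 := by linarith
  have h5 : S z ≤ (2 * S x + 1) / t := by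
    rw [le_div_iff₀ htpos]; linarith
  calc S z ≤ _ := h5
    _ = _ := by rw [ht]; field_simp

theorem aux_l1 {𝕜 X ι : Type*} [RCLike 𝕜] [AddCommGroup X] [Module 𝕜 X]
    (b : Module.Basis ι 𝕜 X) :
    IsNorm 𝕜 (fun x => (b.repr x).sum fun _ a => ‖a‖) := by
  classical
  refine ⟨⟨fun x => Finset.sum_nonneg fun i _ => norm_nonneg _, fun a x => ?_, fun x y => ?_⟩,
    fun x hx => ?_⟩
  · simp only [map_smul]
    rw [Finsupp.sum_smul_index (by simp)]
    simp [Finsupp.sum, Finset.mul_sum]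
  · simp only [map_add]
    have e (f : ι →₀ 𝕜) (s : Finset ι) (hs : f.support ⊆ s) :
        (f.sum fun _ a => ‖a‖) = ∑ i ∈ s, ‖f i‖ :=
      Finsupp.sum_of_support_subset f hs _ (by simp)
    rw [e _ _ Finsupp.support_add, e _ _ (Finset.subset_union_left (s₂ := (b.repr y).support)),
      e (b.repr y) _ (Finset.subset_union_right (s₁ := (b.repr x).support)),
      ← Finset.sum_add_distrib]
    exact Finset.sum_le_sum fun i _ => norm_add_le _ _
  · apply Finset.sum_pos
    · intro i hi
      simpa using hi
    · simpa using hx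

/-- For every seminorm `S ≠ 0` on an infinite-dimensional space there is
a norm with respect to which `S` is discontinuous at every point. -/
theorem exists_norm_seminorm_discontinuous_everywhere
    {𝕜 X : Type*} [RCLike 𝕜] [AddCommGroup X] [Module 𝕜 X]
    (hX : ¬ FiniteDimensional 𝕜 X)
    {S : X → ℝ} (hS : IsSeminorm 𝕜 S) (hS0 : ∃ x, S x ≠ 0) :
    ∃ N : X → ℝ, IsNorm 𝕜 N ∧ ∀ x, ¬ ContAtWRT N S x := by
  classical
  by_contra hcon
  have key : ∀ N : X → ℝ, IsNorm 𝕜 N → ∃ C : ℝ, ∀ x, S x ≤ C * N x := by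
    intro N hN
    by_contra h
    exact hcon ⟨N, hN, aux_disc hS hN h⟩
  let b := Module.Basis.ofVectorSpace 𝕜 X
  let N : X → ℝ := fun x => (b.repr x).sum fun _ a => ‖a‖
  have hN : IsNorm 𝕜 N := aux_l1 b
  have hNb : ∀ i, N (b i) = 1 := by
    intro i
    simp [N]
  have hinf : Infinite (Module.Basis.ofVectorSpaceIndex 𝕜 X) := by
    by_contra hf
    rw [not_infinite_iff_finite] at hf
    exact hX (Module.Finite.of_basis b)
  obtain ⟨i₀, hi₀⟩ : ∃ i, S (b i) ≠ 0 := by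
    by_contra! h0
    obtain ⟨x, hx⟩ := hS0
    apply hx
    have : x ∈ Submodule.span 𝕜 (Set.range b) := by rw [b.span_eq]; trivial
    induction this using Submodule.span_induction with
    | mem x h => obtain ⟨i, rfl⟩ := h; exact h0 i
    | zero => exact aux_zero hS
    | add x y _ _ h1 h2 =>
      have := hS.2.2 x y
      have := hS.1 (x + y)
      by_cases hx' : S x = 0 <;> by_cases hy' : S y = 0 <;> grind
    | smul a x _ h =>
      rw [hS.2.1]
      by_cases hx' : S x = 0 <;> grind
  let f := Infinite.natEmbedding (Module.Basis.ofVectorSpaceIndex 𝕜 X)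
  let g : Module.Basis.ofVectorSpaceIndex 𝕜 X → 𝕜 := fun i =>
    if i = i₀ then 0 else ((Function.invFun f i : ℕ) : 𝕜)
  let φ : X →ₗ[𝕜] 𝕜 := b.constr 𝕜 g
  have hφ : ∀ i, φ (b i) = g i := fun i => b.constr_basis 𝕜 g i
  have hφ0 : φ (b i₀) = 0 := by rw [hφ]; simp [g]
  let T : X →ₗ[𝕜] X := LinearMap.id + φ.smulRight (b i₀)
  have hT : ∀ x, T x = x + φ x • b i₀ := fun x => by simp [T]
  have hN2 : IsNorm 𝕜 (fun x => N (T x)) := by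
    refine ⟨⟨fun x => hN.1.1 _, fun a x => ?_, fun x y => ?_⟩, fun x hx => hN.2 _ ?_⟩
    · simp only [map_smul]; exact hN.1.2.1 _ _
    · simp only [map_add]; exact hN.1.2.2 _ _
    · intro h
      have h1 := congrArg φ h
      rw [hT] at h h1
      simp only [map_add, map_smul, hφ0, smul_zero, add_zero, map_zero] at h1
      rw [h1] at h
      exact hx (by simpa using h)
  obtain ⟨C, hC⟩ := key N hN
  obtain ⟨D, hD⟩ := key _ hN2
  have hpos : 0 < S (b i₀) := lt_of_le_of_ne (hS.1 _) (Ne.symm hi₀)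
  have hb : ∀ i, ‖g i‖ * S (b i₀) ≤ C + D := by
    intro i
    have h1 := hC (b i)
    have h2 := hD (b i - φ (b i) • b i₀)
    have h3 : T (b i - φ (b i) • b i₀) = b i := by
      rw [hT]; simp [hφ0]
    simp only [h3] at h2
    rw [hNb] at h1 h2
    have h4 := hS.2.2 (b i) (-(b i - φ (b i) • b i₀))
    rw [aux_neg hS] at h4
    have h5 : b i + -(b i - φ (b i) • b i₀) = φ (b i) • b i₀ := by abel
    rw [h5, hS.2.1, hφ] at h4
    rw [hφ] at h2
    linarith
  obtain ⟨n, hn⟩ := exists_nat_gt ((C + D) / S (b i₀))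
  rw [div_lt_iff₀ hpos] at hn
  have hf : ∀ m, Function.invFun f (f m) = m := Function.leftInverse_invFun f.injective
  have hm : ∃ m ≥ n, f m ≠ i₀ := by
    by_cases h : f n = i₀
    · refine ⟨n + 1, by omega, fun h' => ?_⟩
      have := f.injective (h.trans h'.symm)
      omega
    · exact ⟨n, le_rfl, h⟩
  obtain ⟨m, hmn, hm⟩ := hm
  have h := hb (f m)
  have hg : ‖g (f m)‖ = m := by
    simp only [g, hm, if_false, hf]
    simp
  rw [hg] at h
  have : (n : ℝ) ≤ m := by exact_mod_cast hmn
  nlinarith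
end

section
/- Let N be a norm on an infinite-dimensional vector space X over 𝔽 (the real or complex numbers). Then there exists a norm N' on X that is discontinuous at every point of X with respect to the topology induced by N, and there exists a proper seminorm S on X that is discontinuous at every point of X with respect to the topology induced by N. -/
theorem not_contAt_of_unbounded {𝕜 X : Type*} [RCLike 𝕜] [AddCommGroup X] [Module 𝕜 X]
    {N S : X → ℝ} (hN : IsSeminorm 𝕜 N) (hS : IsSeminorm 𝕜 S)
    (h : ∀ C : ℝ, ∃ z, N z ≤ 1 ∧ C ≤ S z) (x : X) : ¬ ContAtWRT N S x := by
  intro hc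
  obtain ⟨δ, hδ, hy⟩ := hc 1 one_pos
  obtain ⟨z, hz1, hz2⟩ := h ((1 + 2 * S x) / (δ / 2))
  have hn : ‖((δ / 2 : ℝ) : 𝕜)‖ = δ / 2 := by
    rw [RCLike.norm_ofReal, abs_of_pos (by positivity)]
  have h1 := hy (x + ((δ / 2 : ℝ) : 𝕜) • z) (by
    rw [add_sub_cancel_left, hN.2.1, hn]
    nlinarith)
  have h2 := hS.2.2 (x + ((δ / 2 : ℝ) : 𝕜) • z) ((-1 : 𝕜) • x)
  have h3 : x + ((δ / 2 : ℝ) : 𝕜) • z + (-1 : 𝕜) • x = ((δ / 2 : ℝ) : 𝕜) • z := by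
    rw [neg_one_smul]; abel
  rw [h3, hS.2.1, hS.2.1, hn, norm_neg, norm_one, one_mul] at h2
  rw [div_le_iff₀ (by positivity)] at hz2
  have h4 := (abs_lt.1 h1).2
  linarith

theorem exists_unbounded_functional {𝕜 X : Type*} [RCLike 𝕜] [AddCommGroup X] [Module 𝕜 X]
    (hX : ¬ FiniteDimensional 𝕜 X) {N : X → ℝ} (hN : IsNorm 𝕜 N) :
    ∃ f : X →ₗ[𝕜] 𝕜, (∃ x, x ≠ 0 ∧ f x = 0) ∧ ∀ C : ℝ, ∃ z, N z ≤ 1 ∧ C ≤ ‖f z‖ := by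
  let b := Module.Basis.ofVectorSpace 𝕜 X
  have hinf : Infinite (Module.Basis.ofVectorSpaceIndex 𝕜 X) := by
    by_contra hfin
    rw [not_infinite_iff_finite] at hfin
    exact hX (Module.Finite.of_basis b)
  let e := Infinite.natEmbedding (Module.Basis.ofVectorSpaceIndex 𝕜 X)
  let g : Module.Basis.ofVectorSpaceIndex 𝕜 X → 𝕜 := fun i =>
    ((Function.invFun e i : ℕ) : 𝕜) * ((N (b i) : ℝ) : 𝕜)
  have hg : ∀ n, b.constr 𝕜 g (b (e n)) = (n : 𝕜) * ((N (b (e n)) : ℝ) : 𝕜) := by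
    intro n
    rw [Module.Basis.constr_basis]
    simp only [g]
    rw [Function.leftInverse_invFun e.injective n]
  refine ⟨b.constr 𝕜 g, ⟨b (e 0), b.ne_zero _, by rw [hg]; simp⟩, fun C => ?_⟩
  obtain ⟨n, hn⟩ := exists_nat_ge C
  have hp : 0 < N (b (e n)) := hN.2 _ (b.ne_zero _)
  have hi : ‖(((N (b (e n)))⁻¹ : ℝ) : 𝕜)‖ = (N (b (e n)))⁻¹ := by
    rw [RCLike.norm_ofReal, abs_of_pos (by positivity)]
  refine ⟨(((N (b (e n)))⁻¹ : ℝ) : 𝕜) • b (e n), ?_, ?_⟩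
  · rw [hN.1.2.1, hi, inv_mul_cancel₀ hp.ne']
  · rw [map_smul, hg, smul_eq_mul, norm_mul, hi, norm_mul, RCLike.norm_natCast,
      RCLike.norm_ofReal, abs_of_pos hp]
    field_simp
    exact hn

/-- Given a norm `N` on an infinite-dimensional space, there exist a norm `N'`
and a proper seminorm `S`, both discontinuous at every point w.r.t. the topology of `N`. -/
theorem exists_norm_and_proper_seminorm_discontinuous
    {𝕜 X : Type*} [RCLike 𝕜] [AddCommGroup X] [Module 𝕜 X]
    (hX : ¬ FiniteDimensional 𝕜 X)
    {N : X → ℝ} (hN : IsNorm 𝕜 N) :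
    (∃ N' : X → ℝ, IsNorm 𝕜 N' ∧ ∀ x, ¬ ContAtWRT N N' x) ∧
    (∃ S : X → ℝ, IsProperSeminorm 𝕜 S ∧ ∀ x, ¬ ContAtWRT N S x) := by
  obtain ⟨f, hk, hf⟩ := exists_unbounded_functional hX hN
  have hS : IsSeminorm 𝕜 (fun x => ‖f x‖) :=
    ⟨fun x => norm_nonneg _, fun a x => by simp, fun x y => by
      simpa using norm_add_le (f x) (f y)⟩
  have hS' : IsSeminorm 𝕜 (fun x => N x + ‖f x‖) := by
    refine ⟨fun x => add_nonneg (hN.1.1 x) (norm_nonneg _), fun a x => ?_, fun x y => ?_⟩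
    · have h1 := hN.1.2.1 a x
      have h2 := hS.2.1 a x
      simp only at h2 ⊢
      rw [h1, h2]; ring
    · have h1 := hN.1.2.2 x y
      have h2 := hS.2.2 x y
      simp only at h2 ⊢
      linarith
  refine ⟨⟨fun x => N x + ‖f x‖, ⟨hS', fun x hx => ?_⟩,
    not_contAt_of_unbounded hN.1 hS' fun C => ?_⟩,
    ⟨fun x => ‖f x‖, ⟨hS, ?_, ?_⟩, not_contAt_of_unbounded hN.1 hS hf⟩⟩
  · exact add_pos_of_pos_of_nonneg (hN.2 x hx) (norm_nonneg _)
  · obtain ⟨z, h1, h2⟩ := hf C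
    exact ⟨z, h1, h2.trans (le_add_of_nonneg_left (hN.1.1 z))⟩
  · obtain ⟨z, _, h2⟩ := hf 1
    exact ⟨z, (one_pos.trans_le h2).ne'⟩
  · obtain ⟨x, hx, h0⟩ := hk
    exact ⟨x, hx, by simp [h0]⟩
end

section
/- There exists a proper seminorm S on the space c₀₀ of finitely supported 𝔽-valued sequences (𝔽 the real or complex numbers) that is discontinuous at every point of c₀₀ with respect to the topology induced by the norm N₁(x) = Σᵢ |ξᵢ| and also discontinuous at every point with respect to the topology induced by the norm N∞(x) = maxᵢ |ξᵢ|; in particular, a seminorm can be ubiquitously discontinuous with respect to two non-equivalent norms. -/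
/-- The norm `N₁(x) = Σᵢ |ξᵢ|` on the space `c₀₀ = ℕ →₀ 𝕜` of finitely
supported sequences. -/
noncomputable def c00N1 {𝕜 : Type*} [RCLike 𝕜] (x : ℕ →₀ 𝕜) : ℝ :=
  ∑ i ∈ x.support, ‖x i‖

/-- The norm `N∞(x) = maxᵢ |ξᵢ|` on the space `c₀₀ = ℕ →₀ 𝕜`. -/
noncomputable def c00Ninf {𝕜 : Type*} [RCLike 𝕜] (x : ℕ →₀ 𝕜) : ℝ :=
  ⨆ i, ‖x i‖

/-- The seminorm `S(x) = |ξ₁|` (modulus of the first coordinate) on `c₀₀`. -/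
def c00S {𝕜 : Type*} [RCLike 𝕜] (x : ℕ →₀ 𝕜) : ℝ := ‖x 0‖

theorem c00N1_single_aux {𝕜 : Type*} [RCLike 𝕜] (n : ℕ) (c : 𝕜) :
    c00N1 (Finsupp.single n c) = ‖c‖ := by
  have h : c00N1 (Finsupp.single n c) = (Finsupp.single n c).sum (fun _ a => ‖a‖) := rfl
  rw [h, Finsupp.sum_single_index (by simp)]

theorem c00Ninf_single_le_aux {𝕜 : Type*} [RCLike 𝕜] (n : ℕ) (c : 𝕜) :
    c00Ninf (Finsupp.single n c) ≤ ‖c‖ := by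
  unfold c00Ninf
  refine ciSup_le fun i => ?_
  by_cases h : n = i
  · simp [h]
  · simp [Finsupp.single_apply, h]

theorem discont_aux {𝕜 : Type*} [RCLike 𝕜] (N : (ℕ →₀ 𝕜) → ℝ)
    (hN : ∀ n c, N (Finsupp.single n c) ≤ ‖c‖) (x : ℕ →₀ 𝕜) :
    ¬ ContAtWRT N (fun x => ‖Finsupp.linearCombination 𝕜 (fun i : ℕ => (i : 𝕜)) x‖) x := by
  intro h
  obtain ⟨δ, hδ, h⟩ := h 1 one_pos
  set f := Finsupp.linearCombination 𝕜 (fun i : ℕ => (i : 𝕜)) with hf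
  set K : ℝ := 2 * ‖f x‖ + 1 with hK
  have hKpos : 0 < K := by positivity
  obtain ⟨n, hn⟩ := exists_nat_gt (K / δ)
  have hnpos : (0 : ℝ) < n := lt_trans (by positivity) hn
  have hn0 : (n : 𝕜) ≠ 0 := by
    have : n ≠ 0 := by rintro rfl; simp at hnpos
    exact_mod_cast this
  have h1 := h (x + Finsupp.single n ((K : 𝕜) / n)) (by
    rw [add_sub_cancel_left]
    refine lt_of_le_of_lt (hN _ _) ?_
    rw [norm_div, RCLike.norm_ofReal, RCLike.norm_natCast, abs_of_pos hKpos, div_lt_iff₀ hnpos]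
    rw [div_lt_iff₀ hδ] at hn
    linarith)
  have h2 : f (x + Finsupp.single n ((K : 𝕜) / n)) = f x + (K : 𝕜) := by
    rw [map_add, hf, Finsupp.linearCombination_single, smul_eq_mul, div_mul_cancel₀ _ hn0]
  simp only [h2] at h1
  have h3 : K ≤ ‖f x + (K : 𝕜)‖ + ‖f x‖ := by
    have := norm_sub_le (f x + (K : 𝕜)) (f x)
    rwa [add_sub_cancel_left, RCLike.norm_ofReal, abs_of_pos hKpos] at this
  have := (abs_lt.1 h1).2
  linarith

/-- There is a proper seminorm on `c₀₀` which is discontinuous at every point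
w.r.t. both `N₁` and `N∞`; in particular a seminorm can be ubiquitously discontinuous
with respect to two non-equivalent norms. -/
theorem c00_exists_proper_seminorm_discontinuous_two_norms {𝕜 : Type*} [RCLike 𝕜] :
    (∃ S : (ℕ →₀ 𝕜) → ℝ, IsProperSeminorm 𝕜 S ∧
      (∀ x, ¬ ContAtWRT c00N1 S x) ∧ (∀ x, ¬ ContAtWRT c00Ninf S x)) ∧
    ¬ NormEquiv (c00N1 (𝕜 := 𝕜)) (c00Ninf (𝕜 := 𝕜)) := by
  refine ⟨⟨fun x => ‖Finsupp.linearCombination 𝕜 (fun i : ℕ => (i : 𝕜)) x‖,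
    ⟨⟨fun x => norm_nonneg _, fun a x => ?_, fun x y => ?_⟩, ⟨Finsupp.single 1 1, ?_⟩,
      ⟨Finsupp.single 0 1, ?_, ?_⟩⟩,
    discont_aux _ (fun n c => (c00N1_single_aux n c).le),
    discont_aux _ c00Ninf_single_le_aux⟩, ?_⟩
  · simp only [map_smul, norm_smul]
  · simp only [map_add]
    exact norm_add_le _ _
  · simp
  · simp
  · simp
  · rintro ⟨β, γ, hβ, -, h⟩
    obtain ⟨n, hn⟩ := exists_nat_gt (1 / β)
    let x : ℕ →₀ 𝕜 := Finsupp.indicator (Finset.range n) (fun _ _ => 1)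
    have hx : ∀ i, x i = if i ∈ Finset.range n then 1 else 0 := fun i => by
      simp [x, Finsupp.indicator_apply]
    have h1 : c00N1 x = n := by
      have hs : x.support = Finset.range n := by
        ext i
        rw [Finsupp.mem_support_iff, hx]
        simp
      unfold c00N1
      rw [hs, Finset.sum_congr rfl (g := fun _ => (1 : ℝ))]
      · simp
      · intro i hi
        rw [hx, if_pos hi, norm_one]
    have h2 : c00Ninf x ≤ 1 := by
      unfold c00Ninf
      refine ciSup_le fun i => ?_
      rw [hx]
      split_ifs <;> simp
    have h3 := (h x).1
    rw [h1] at h3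
    rw [div_lt_iff₀ hβ] at hn
    linarith
end

section
/- Let X be an infinite-dimensional vector space over 𝔽 (the real or complex numbers), and let N, N₁, N₂ be norms on X such that N₁ and N₂ are complete and N is continuous at every point of X with respect to the topologies induced by N₁ and by N₂. Then the function N'(x) = max{N₁(x), N₂(x)} is a complete norm on X. -/
/-- If `N` is a norm on an infinite-dimensional space which is continuous
everywhere w.r.t. two complete norms `N₁`, `N₂`, then `N'(x) = max {N₁ x, N₂ x}` is a
complete norm. -/
theorem max_of_complete_norms_complete
    {𝕜 X : Type*} [RCLike 𝕜] [AddCommGroup X] [Module 𝕜 X]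
    (hX : ¬ FiniteDimensional 𝕜 X)
    {N N₁ N₂ : X → ℝ} (hN : IsNorm 𝕜 N) (h1 : IsNorm 𝕜 N₁) (h2 : IsNorm 𝕜 N₂)
    (h1c : NComplete N₁) (h2c : NComplete N₂)
    (hc1 : ∀ x, ContAtWRT N₁ N x) (hc2 : ∀ x, ContAtWRT N₂ N x) :
    IsNorm 𝕜 (fun x => max (N₁ x) (N₂ x)) ∧ NComplete (fun x => max (N₁ x) (N₂ x)) := by
  obtain ⟨⟨n0, nh, nt⟩, np⟩ := hN
  obtain ⟨⟨a0, ah, atri⟩, ap⟩ := h1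
  obtain ⟨⟨b0, bh, bt⟩, bp⟩ := h2
  refine ⟨⟨⟨fun x => le_max_of_le_left (a0 x), fun a x => ?_, fun x y => ?_⟩,
    fun x hx => lt_max_of_lt_left (ap x hx)⟩, fun u hu => ?_⟩
  · simp only [ah, bh]
    exact (mul_max_of_nonneg _ _ (norm_nonneg a)).symm
  · exact max_le ((atri x y).trans (add_le_add (le_max_left _ _) (le_max_left _ _)))
      ((bt x y).trans (add_le_add (le_max_right _ _) (le_max_right _ _)))
  · have hz : N 0 = 0 := by simpa using nh 0 0
    have hneg : ∀ z, N (-z) = N z := fun z => by simpa using nh (-1) z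
    obtain ⟨x, hx⟩ := h1c u (fun ε hε => by
      obtain ⟨M, hM⟩ := hu ε hε
      exact ⟨M, fun n hn m hm => (le_max_left _ _).trans_lt (hM n hn m hm)⟩)
    obtain ⟨y, hy⟩ := h2c u (fun ε hε => by
      obtain ⟨M, hM⟩ := hu ε hε
      exact ⟨M, fun n hn m hm => (le_max_right _ _).trans_lt (hM n hn m hm)⟩)
    have hxy : x = y := by
      by_contra hne
      have hpos : 0 < N (x - y) := np _ (sub_ne_zero.mpr hne)
      obtain ⟨d1, hd1, H1⟩ := hc1 0 (N (x - y) / 2) (by linarith)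
      obtain ⟨d2, hd2, H2⟩ := hc2 0 (N (x - y) / 2) (by linarith)
      obtain ⟨M1, hM1⟩ := hx d1 hd1
      obtain ⟨M2, hM2⟩ := hy d2 hd2
      have e1 := H1 (u (max M1 M2) - x) (by simpa using hM1 _ (le_max_left _ _))
      have e2 := H2 (u (max M1 M2) - y) (by simpa using hM2 _ (le_max_right _ _))
      rw [hz, sub_zero] at e1 e2
      have e3 := nt (-(u (max M1 M2) - x)) (u (max M1 M2) - y)
      rw [hneg, show -(u (max M1 M2) - x) + (u (max M1 M2) - y) = x - y by abel] at e3
      linarith [le_abs_self (N (u (max M1 M2) - x)), le_abs_self (N (u (max M1 M2) - y))]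
    subst hxy
    refine ⟨x, fun ε hε => ?_⟩
    obtain ⟨M1, hM1⟩ := hx ε hε
    obtain ⟨M2, hM2⟩ := hy ε hε
    exact ⟨max M1 M2, fun n hn => max_lt (hM1 n ((le_max_left _ _).trans hn))
      (hM2 n ((le_max_right _ _).trans hn))⟩
end

section
/- Let X be an infinite-dimensional vector space over 𝔽 (the real or complex numbers), and let N be a norm on X that is continuous at every point of X with respect to the topologies induced by two complete norms N₁ and N₂ on X. Then N₁ and N₂ are equivalent: there exist positive constants β ≤ γ with β N₁(x) ≤ N₂(x) ≤ γ N₁(x) for all x ∈ X. -/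
/-- Type synonym used to carry the metric of a norm. -/
def NSyn (X : Type*) (_N : X → ℝ) : Type _ := X

/-- The group structure of the synonym. -/
instance NSyn.grp (X : Type*) [AddCommGroup X] (N : X → ℝ) : AddCommGroup (NSyn X N) :=
  inferInstanceAs (AddCommGroup X)

/-- The module structure of the synonym. -/
instance NSyn.mdl (𝕜 X : Type*) [RCLike 𝕜] [AddCommGroup X] [Module 𝕜 X] (N : X → ℝ) :
    Module 𝕜 (NSyn X N) :=
  inferInstanceAs (Module 𝕜 X)

theorem IsNorm.map_zero {𝕜 X : Type*} [RCLike 𝕜] [AddCommGroup X] [Module 𝕜 X]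
    {N : X → ℝ} (h : IsNorm 𝕜 N) : N 0 = 0 := by
  have := h.1.2.1 (0 : 𝕜) (0 : X)
  simpa using this

theorem IsNorm.map_neg {𝕜 X : Type*} [RCLike 𝕜] [AddCommGroup X] [Module 𝕜 X]
    {N : X → ℝ} (h : IsNorm 𝕜 N) (x : X) : N (-x) = N x := by
  have := h.1.2.1 (-1 : 𝕜) x
  simpa using this

/-- The normed group attached to a norm. -/
@[reducible] def IsNorm.nacg {𝕜 X : Type*} [RCLike 𝕜] [AddCommGroup X] [Module 𝕜 X]
    {N : X → ℝ} (h : IsNorm 𝕜 N) : NormedAddCommGroup (NSyn X N) :=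
  AddGroupNorm.toNormedAddCommGroup (E := NSyn X N)
    { toFun := N
      map_zero' := h.map_zero
      add_le' := h.1.2.2
      neg' := h.map_neg
      eq_zero_of_map_eq_zero' := fun x hx => by
        by_contra hne
        exact (h.2 x hne).ne' hx }

/-- The normed space attached to a norm. -/
@[reducible] def IsNorm.nspace {𝕜 X : Type*} [RCLike 𝕜] [AddCommGroup X] [Module 𝕜 X]
    {N : X → ℝ} (h : IsNorm 𝕜 N) : @NormedSpace 𝕜 (NSyn X N) _ h.nacg.toSeminormedAddCommGroup :=
  letI := h.nacg
  { NSyn.mdl 𝕜 X N with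
    norm_smul_le := fun a x => (h.1.2.1 a x).le }

theorem IsNorm.dist_eq {𝕜 X : Type*} [RCLike 𝕜] [AddCommGroup X] [Module 𝕜 X]
    {N : X → ℝ} (h : IsNorm 𝕜 N) (x y : X) :
    @dist (NSyn X N) h.nacg.toPseudoMetricSpace.toDist x y = N (x - y) :=
  letI := h.nacg
  dist_eq_norm (E := NSyn X N) x y

theorem IsNorm.completeSpace {𝕜 X : Type*} [RCLike 𝕜] [AddCommGroup X] [Module 𝕜 X]
    {N : X → ℝ} (h : IsNorm 𝕜 N) (hc : NComplete N) :
    @CompleteSpace (NSyn X N) h.nacg.toPseudoMetricSpace.toUniformSpace := by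
  letI := h.nacg
  refine Metric.complete_of_cauchySeq_tendsto (fun u hu => ?_)
  rw [Metric.cauchySeq_iff] at hu
  obtain ⟨x, hx⟩ := hc u (fun ε hε => by
    obtain ⟨M, hM⟩ := hu ε hε
    exact ⟨M, fun n hn m hm =>
      (h.dist_eq (u n) (u m)).symm.trans_lt (hM n hn m hm)⟩)
  refine ⟨x, Metric.tendsto_atTop.2 (fun ε hε => ?_)⟩
  obtain ⟨M, hM⟩ := hx ε hε
  exact ⟨M, fun n hn => (h.dist_eq (u n) x).trans_lt (hM n hn)⟩

theorem IsNorm.small {𝕜 X : Type*} [RCLike 𝕜] [AddCommGroup X] [Module 𝕜 X]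
    {N N₁ : X → ℝ} (hN : IsNorm 𝕜 N) (h1 : IsNorm 𝕜 N₁) (hc : ∀ x, ContAtWRT N₁ N x)
    {u : ℕ → X} {x : X}
    (hu : @Filter.Tendsto ℕ (NSyn X N₁) u Filter.atTop
      (@nhds _ h1.nacg.toPseudoMetricSpace.toUniformSpace.toTopologicalSpace x))
    {ε : ℝ} (hε : 0 < ε) : ∃ M, ∀ n ≥ M, N (u n - x) < ε := by
  letI := h1.nacg
  obtain ⟨δ, hδ, H⟩ := hc 0 ε hε
  obtain ⟨M, hM⟩ := Metric.tendsto_atTop.1 hu δ hδ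
  refine ⟨M, fun n hn => ?_⟩
  have h3 : N₁ (u n - x) < δ := by
    rw [← h1.dist_eq]; exact hM n hn
  have h4 := H (u n - x) (by simpa using h3)
  rw [hN.map_zero, sub_zero] at h4
  exact (abs_lt.1 h4).2

theorem one_sided_bound {𝕜 X : Type*} [RCLike 𝕜] [AddCommGroup X] [Module 𝕜 X]
    {N N₁ N₂ : X → ℝ} (hN : IsNorm 𝕜 N) (h1 : IsNorm 𝕜 N₁) (h2 : IsNorm 𝕜 N₂)
    (h1c : NComplete N₁) (h2c : NComplete N₂)
    (hc1 : ∀ x, ContAtWRT N₁ N x) (hc2 : ∀ x, ContAtWRT N₂ N x) :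
    ∃ C > 0, ∀ x, N₂ x ≤ C * N₁ x := by
  letI := h1.nacg
  letI := h2.nacg
  letI := h1.nspace
  letI := h2.nspace
  haveI := h1.completeSpace h1c
  haveI := h2.completeSpace h2c
  let f : NSyn X N₁ →ₗ[𝕜] NSyn X N₂ :=
    { toFun := fun x => x
      map_add' := fun _ _ => rfl
      map_smul' := fun _ _ => rfl }
  have hf : Continuous f := by
    refine LinearMap.continuous_of_seq_closed_graph f (fun u x y hu hv => ?_)
    by_contra hne
    let x' : X := x
    let y' : X := y
    let u' : ℕ → X := u
    have hpos : 0 < N (y' - x') := hN.2 _ (sub_ne_zero.2 hne)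
    obtain ⟨M, hM⟩ := hN.small h1 hc1 (u := u') (x := x') hu (half_pos hpos)
    obtain ⟨K, hK⟩ := hN.small h2 hc2 (u := u') (x := y') hv (half_pos hpos)
    have a := hM (max M K) (le_max_left _ _)
    have b := hK (max M K) (le_max_right _ _)
    have c := hN.1.2.2 (u' (max M K) - x') (-(u' (max M K) - y'))
    rw [hN.map_neg] at c
    have e : u' (max M K) - x' + -(u' (max M K) - y') = y' - x' := by abel
    rw [e] at c
    linarith
  obtain ⟨C, hC, H⟩ := (⟨f, hf⟩ : NSyn X N₁ →L[𝕜] NSyn X N₂).bound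
  exact ⟨C, hC, fun x => H x⟩

/-- If a norm `N` on an infinite-dimensional space is continuous everywhere
w.r.t. two complete norms `N₁` and `N₂`, then `N₁` and `N₂` are equivalent. -/
theorem complete_norms_equivalent_of_common_continuous_norm
    {𝕜 X : Type*} [RCLike 𝕜] [AddCommGroup X] [Module 𝕜 X]
    (hX : ¬ FiniteDimensional 𝕜 X)
    {N N₁ N₂ : X → ℝ} (hN : IsNorm 𝕜 N) (h1 : IsNorm 𝕜 N₁) (h2 : IsNorm 𝕜 N₂)
    (h1c : NComplete N₁) (h2c : NComplete N₂)
    (hc1 : ∀ x, ContAtWRT N₁ N x) (hc2 : ∀ x, ContAtWRT N₂ N x) :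
    NormEquiv N₁ N₂ := by
  obtain ⟨C, hC, H⟩ := one_sided_bound hN h1 h2 h1c h2c hc1 hc2
  obtain ⟨D, hD, K⟩ := one_sided_bound hN h2 h1 h2c h1c hc2 hc1
  refine ⟨D⁻¹, max C D⁻¹, inv_pos.2 hD, le_max_right _ _, fun x => ⟨?_, ?_⟩⟩
  · rw [inv_mul_le_iff₀ hD]
    exact K x
  · exact (H x).trans (mul_le_mul_of_nonneg_right (le_max_left _ _) (h1.1.1 x))
end

section
/- On the space ℓ¹ of absolutely summable 𝔽-valued sequences (𝔽 the real or complex numbers), there exist a proper seminorm S and two complete norms N₁ and N₂ that are not equivalent, such that S is continuous at every point of ℓ¹ with respect to the topologies induced by both N₁ and N₂. (One may take N₁(x) = Σᵢ |ξᵢ| and S(x) = |ξ₁|.) In particular, a proper seminorm can be ubiquitously continuous with respect to two non-equivalent complete norms. -/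
lemma aux_complete {𝕜 X : Type*} [RCLike 𝕜] [NormedAddCommGroup X] [NormedSpace 𝕜 X]
    [CompleteSpace X] (T : X →ₗ[𝕜] X) (hT : Function.Surjective T) :
    NComplete (fun x => ‖T x‖) := by
  intro u hu
  have hc : CauchySeq (fun n => T (u n)) := by
    rw [Metric.cauchySeq_iff]
    intro ε hε
    obtain ⟨M, hM⟩ := hu ε hε
    refine ⟨M, fun n hn m hm => ?_⟩
    have := hM n hn m hm
    simpa [dist_eq_norm] using this
  obtain ⟨y, hy⟩ := cauchySeq_tendsto_of_complete hc
  obtain ⟨x, rfl⟩ := hT y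
  refine ⟨x, fun ε hε => ?_⟩
  rw [Metric.tendsto_atTop] at hy
  obtain ⟨M, hM⟩ := hy ε hε
  refine ⟨M, fun n hn => ?_⟩
  simpa [dist_eq_norm] using hM n hn

lemma aux_norm {𝕜 X : Type*} [RCLike 𝕜] [NormedAddCommGroup X] [NormedSpace 𝕜 X]
    (T : X →ₗ[𝕜] X) (hT : Function.Injective T) :
    IsNorm 𝕜 (fun x => ‖T x‖) := by
  refine ⟨⟨fun x => norm_nonneg _, fun a x => ?_, fun x y => ?_⟩, fun x hx => ?_⟩
  · simp [norm_smul]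
  · simpa using norm_add_le (T x) (T y)
  · have : T x ≠ 0 := fun h => hx (hT (by simpa using h))
    simpa using this

/-- The unit vectors of `ℓ¹`. -/
noncomputable def auxE (𝕜 : Type*) [RCLike 𝕜] (n : ℕ) : lp (fun _ : ℕ => 𝕜) 1 :=
  lp.single 1 n (1 : 𝕜)

lemma auxE_apply (𝕜 : Type*) [RCLike 𝕜] (n k : ℕ) :
    auxE 𝕜 n k = if k = n then 1 else 0 := by
  simp [auxE, lp.single_apply, Pi.single_apply]

lemma auxE_norm (𝕜 : Type*) [RCLike 𝕜] (n : ℕ) : ‖auxE 𝕜 n‖ = 1 := by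
  rw [auxE, lp.norm_single (by norm_num)]
  simp

lemma aux_functional (𝕜 : Type*) [RCLike 𝕜] (c : ℕ → 𝕜) :
    ∃ f : lp (fun _ : ℕ => 𝕜) 1 →ₗ[𝕜] 𝕜, ∀ n, f (auxE 𝕜 n) = c n := by
  have hli : LinearIndependent 𝕜 (auxE 𝕜) := by
    rw [linearIndependent_iff']
    intro s g hg i hi
    have h := congrArg (fun x : lp (fun _ : ℕ => 𝕜) 1 => x i) hg
    simp only [lp.coeFn_sum, Finset.sum_apply, lp.coeFn_smul, Pi.smul_apply, auxE_apply,
      lp.coeFn_zero, Pi.zero_apply] at h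
    simpa [hi] using h
  obtain ⟨g, hg⟩ := LinearMap.exists_leftInverse_of_injective
    (Finsupp.linearCombination 𝕜 (auxE 𝕜)) (LinearMap.ker_eq_bot.2 hli)
  refine ⟨Finsupp.linearCombination 𝕜 c ∘ₗ g, fun n => ?_⟩
  have := LinearMap.congr_fun hg (Finsupp.single n 1)
  simp only [LinearMap.comp_apply, Finsupp.linearCombination_single, one_smul,
    LinearMap.id_apply] at this
  simp [this]

/-- On `ℓ¹` there are a proper seminorm `S` and two non-equivalent complete
norms `N₁`, `N₂` such that `S` is continuous at every point w.r.t. both; one may take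
`N₁(x) = Σᵢ |ξᵢ|` and `S(x) = |ξ₁|`. -/
theorem l1_proper_seminorm_continuous_wrt_two_nonequivalent_complete_norms
    {𝕜 : Type*} [RCLike 𝕜] :
    ∃ S N₁ N₂ : lp (fun _ : ℕ => 𝕜) 1 → ℝ,
      IsProperSeminorm 𝕜 S ∧
      IsNorm 𝕜 N₁ ∧ NComplete N₁ ∧
      IsNorm 𝕜 N₂ ∧ NComplete N₂ ∧
      ¬ NormEquiv N₁ N₂ ∧
      (∀ x, ContAtWRT N₁ S x) ∧ (∀ x, ContAtWRT N₂ S x) ∧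
      (∀ x, N₁ x = ∑' i, ‖x i‖) ∧ (∀ x, S x = ‖x 0‖) := by
  obtain ⟨f, hf⟩ := aux_functional 𝕜 (fun n => if n = 1 then 0 else (n : 𝕜))
  let v := auxE 𝕜 1
  have hfv : f v = 0 := by simp [v, hf]
  let T : lp (fun _ : ℕ => 𝕜) 1 →ₗ[𝕜] lp (fun _ : ℕ => 𝕜) 1 :=
    LinearMap.id + f.smulRight v
  have hTx : ∀ x, T x = x + f x • v := fun x => rfl
  have hT0 : ∀ x, T x 0 = x 0 := by
    intro x
    rw [hTx, lp.coeFn_add, Pi.add_apply, lp.coeFn_smul, Pi.smul_apply, auxE_apply]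
    simp
  have hinj : Function.Injective T := by
    rw [← LinearMap.ker_eq_bot, LinearMap.ker_eq_bot']
    intro x hx
    have h1 : f x = 0 := by
      have := congrArg f hx
      simpa [hTx, hfv] using this
    simpa [hTx, h1] using hx
  have hsurj : Function.Surjective T := by
    intro y
    refine ⟨y - f y • v, ?_⟩
    simp [hTx, hfv]
  have hcoord : ∀ x : lp (fun _ : ℕ => 𝕜) 1, ‖x 0‖ ≤ ‖x‖ := fun x =>
    lp.norm_apply_le_norm (by norm_num) x 0
  have hcont : ∀ N : lp (fun _ : ℕ => 𝕜) 1 → ℝ, (∀ x, ‖x 0‖ ≤ N x) →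
      ∀ x, ContAtWRT N (fun x => ‖x 0‖) x := by
    intro N hN x ε hε
    refine ⟨ε, hε, fun y hy => ?_⟩
    have h := hN (y - x)
    rw [lp.coeFn_sub, Pi.sub_apply] at h
    exact (abs_norm_sub_norm_le _ _).trans_lt (h.trans_lt hy)
  refine ⟨fun x => ‖x 0‖, fun x => ‖x‖, fun x => ‖T x‖, ⟨⟨fun x => norm_nonneg _, ?_, ?_⟩,
    ⟨auxE 𝕜 0, ?_⟩, auxE 𝕜 1, ?_, ?_⟩, aux_norm LinearMap.id Function.injective_id,
    aux_complete (𝕜 := 𝕜) LinearMap.id Function.surjective_id, aux_norm T hinj,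
    aux_complete T hsurj, ?_, hcont _ hcoord, hcont _ ?_, ?_, fun x => rfl⟩
  · intro a x
    simp [lp.coeFn_smul]
  · intro x y
    simpa [lp.coeFn_add] using norm_add_le (x 0) (y 0)
  · simp [auxE_apply]
  · intro h
    have := auxE_norm 𝕜 1
    simp [h] at this
  · simp [auxE_apply]
  · rintro ⟨β, γ, -, -, h⟩
    obtain ⟨n, hn⟩ := exists_nat_gt (max (γ + 1) 1)
    have hn1 : γ + 1 < n := (le_max_left _ _).trans_lt hn
    have hn2 : n ≠ 1 := by
      rintro rfl
      have := (le_max_right (γ + 1) 1).trans_lt hn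
      simp at this
    have h2 := (h (auxE 𝕜 n)).2
    have h3 : ‖f (auxE 𝕜 n) • v‖ = n := by
      rw [norm_smul, auxE_norm, hf, if_neg hn2]
      simp
    have h4 := norm_sub_le (T (auxE 𝕜 n)) (auxE 𝕜 n)
    rw [hTx, add_sub_cancel_left, h3, ← hTx, auxE_norm] at h4
    simp only [auxE_norm] at h2
    linarith
  · intro x
    rw [← hT0]
    exact hcoord _
  · intro x
    have := lp.norm_eq_tsum_rpow (p := 1) (by norm_num) x
    simpa using this
end
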